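/- arXiv:1906.02685 — 3 statements merged into one kernel-verified Lean document; each statement's English description precedes it below -/
import Mathlib

section
/- Let λ > 0 and φ_1, …, φ_T ∈ ℝ^d with ‖φ_t‖₂ ≤ 1 for all t, and define V_0 = λ I_d and V_t = V_{t-1} + φ_t φ_tᵀ. Then Σ_{t=1}^T ‖φ_t‖_{V_t^{-1}} ≤ √(2 T log(det V_T / det V_0)). -/
open Matrix Finset

/-- Regularized design matrix `V_t = λ I_d + Σ_{s=1}^t φ_s φ_sᵀ`. -/
noncomputable def Vmat {d : ℕ} (lam : ℝ) (φ : ℕ → Fin d → ℝ) (t : ℕ) : Matrix (Fin d) (Fin d) ℝ :=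
  lam • 1 + ∑ s ∈ Finset.Icc 1 t, vecMulVec (φ s) (φ s)

/-- Mahalanobis (semi-)norm `‖x‖_M = √(xᵀ M x)`. -/
noncomputable def mahal {d : ℕ} (M : Matrix (Fin d) (Fin d) ℝ) (x : Fin d → ℝ) : ℝ :=
  Real.sqrt (x ⬝ᵥ M.mulVec x)

theorem vecMulVec_self_posSemidef {n : Type*} [Fintype n] (v : n → ℝ) :
    (vecMulVec v v).PosSemidef := by
  simpa using posSemidef_vecMulVec_self_star v

theorem Vmat_succ {d : ℕ} (lam : ℝ) (φ : ℕ → Fin d → ℝ) (t : ℕ) :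
    Vmat lam φ (t + 1) = Vmat lam φ t + vecMulVec (φ (t + 1)) (φ (t + 1)) := by
  simp only [Vmat, Finset.sum_Icc_succ_top (Nat.le_add_left 1 t), add_assoc]

theorem Vmat_posDef {d : ℕ} {lam : ℝ} (hlam : 0 < lam) (φ : ℕ → Fin d → ℝ) (t : ℕ) :
    (Vmat lam φ t).PosDef := by
  induction t with
  | zero => simpa [Vmat] using PosDef.one.smul hlam
  | succ t ih =>
    rw [Vmat_succ]
    exact ih.add_posSemidef (vecMulVec_self_posSemidef _)

/-- Matrix determinant lemma for removing a rank-one term. -/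
theorem det_sub_vecMulVec {n : Type*} [Fintype n] [DecidableEq n] {A : Matrix n n ℝ}
    (hA : IsUnit A.det) (v : n → ℝ) :
    (A - vecMulVec v v).det = A.det * (1 - v ⬝ᵥ A⁻¹ *ᵥ v) := by
  have h := det_add_replicateCol_mul_replicateRow (ι := Unit) hA (-v) v
  rw [← vecMulVec_eq Unit, neg_vecMulVec, ← sub_eq_add_neg] at h
  rw [h, Matrix.mul_assoc, ← replicateCol_mulVec, det_unique (n := Unit), Matrix.add_apply,
    replicateRow_mul_replicateCol_apply, mulVec_neg, dotProduct_neg, one_apply_eq, sub_eq_add_neg]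

/-- One step of the elliptical potential argument. -/
theorem quadForm_inv_le_log_det {d : ℕ} {lam : ℝ} (hlam : 0 < lam) (φ : ℕ → Fin d → ℝ) (t : ℕ) :
    φ (t + 1) ⬝ᵥ (Vmat lam φ (t + 1))⁻¹ *ᵥ φ (t + 1)
      ≤ Real.log (Vmat lam φ (t + 1)).det - Real.log (Vmat lam φ t).det := by
  have h0 := (Vmat_posDef hlam φ t).det_pos
  have h1 := (Vmat_posDef hlam φ (t + 1)).det_pos
  have hdet := det_sub_vecMulVec h1.ne'.isUnit (φ (t + 1))
  rw [← eq_sub_of_add_eq (Vmat_succ lam φ t).symm] at hdet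
  have hlog := Real.log_le_sub_one_of_pos (div_pos h0 h1)
  rw [Real.log_div h0.ne' h1.ne', hdet, mul_div_cancel_left₀ _ h1.ne', ← hdet] at hlog
  linarith

theorem mahal_inv_sq {d : ℕ} {lam : ℝ} (hlam : 0 < lam) (φ : ℕ → Fin d → ℝ) (t : ℕ)
    (x : Fin d → ℝ) :
    mahal (Vmat lam φ t)⁻¹ x ^ 2 = x ⬝ᵥ (Vmat lam φ t)⁻¹ *ᵥ x :=
  Real.sq_sqrt (by simpa using (Vmat_posDef hlam φ t).inv.posSemidef.dotProduct_mulVec_nonneg x)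

theorem sum_mahal_inv_sq_le {d : ℕ} {lam : ℝ} (hlam : 0 < lam) (φ : ℕ → Fin d → ℝ) (T : ℕ) :
    ∑ t ∈ Finset.Icc 1 T, mahal (Vmat lam φ t)⁻¹ (φ t) ^ 2
      ≤ Real.log (Vmat lam φ T).det - Real.log (Vmat lam φ 0).det := by
  induction T with
  | zero => simp
  | succ T ih =>
    rw [Finset.sum_Icc_succ_top (Nat.le_add_left 1 T), mahal_inv_sq hlam]
    linarith [quadForm_inv_le_log_det hlam φ T]

/-- if `‖φ_t‖₂ ≤ 1` for all `t`, then
`Σ_{t=1}^T ‖φ_t‖_{V_t⁻¹} ≤ √(2 T log(det V_T / det V_0))`. -/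
theorem sum_feature_norms_le {d : ℕ} (lam : ℝ) (hlam : 0 < lam) (T : ℕ)
    (φ : ℕ → Fin d → ℝ) (hφ : ∀ t, Real.sqrt (φ t ⬝ᵥ φ t) ≤ 1) :
    ∑ t ∈ Finset.Icc 1 T, mahal (Vmat lam φ t)⁻¹ (φ t)
      ≤ Real.sqrt (2 * T * Real.log ((Vmat lam φ T).det / (Vmat lam φ 0).det)) := by
  rw [Real.log_div (Vmat_posDef hlam φ T).det_pos.ne' (Vmat_posDef hlam φ 0).det_pos.ne']
  apply Real.le_sqrt_of_sq_le
  have hsum := sum_mahal_inv_sq_le hlam φ T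
  have hnonneg : 0 ≤ ∑ t ∈ Finset.Icc 1 T, mahal (Vmat lam φ t)⁻¹ (φ t) ^ 2 :=
    Finset.sum_nonneg fun _ _ => sq_nonneg _
  calc (∑ t ∈ Finset.Icc 1 T, mahal (Vmat lam φ t)⁻¹ (φ t)) ^ 2
      ≤ T * ∑ t ∈ Finset.Icc 1 T, mahal (Vmat lam φ t)⁻¹ (φ t) ^ 2 := by
        simpa using sq_sum_le_card_mul_sum_sq (s := Finset.Icc 1 T)
          (f := fun t => mahal (Vmat lam φ t)⁻¹ (φ t))
    _ ≤ T * (2 * (Real.log (Vmat lam φ T).det - Real.log (Vmat lam φ 0).det)) := by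
        gcongr
        linarith
    _ = _ := by ring
end

section
/- Let λ > 0 and φ_1, …, φ_T ∈ ℝ^d with ‖φ_t‖₂ ≤ 1 for all t, and define V_0 = λ I_d and V_T = V_0 + Σ_{t=1}^T φ_t φ_tᵀ. Then log(det V_T / det V_0) ≤ d log(1 + T/(λ d)). -/
open Matrix Finset

/-- The arithmetic-geometric mean inequality for the eigenvalues of a positive definite matrix, in
logarithmic form: a bound on the trace yields a bound on the log-determinant. -/
theorem Matrix.PosDef.log_det_le_of_trace_le {n : Type*} [Fintype n] [DecidableEq n]
    {A : Matrix n n ℝ} (hA : A.PosDef) {m : ℝ} (hm : 0 < m)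
    (htr : A.trace ≤ Fintype.card n * m) :
    Real.log A.det ≤ Fintype.card n * Real.log m := by
  have hpos := hA.eigenvalues_pos
  have hdet : A.det = ∏ i, hA.1.eigenvalues i := by
    simpa using hA.1.det_eq_prod_eigenvalues
  have htrace : A.trace = ∑ i, hA.1.eigenvalues i := by
    simpa using hA.1.trace_eq_sum_eigenvalues
  rw [hdet, Real.log_prod fun i _ => (hpos i).ne']
  have hlog : ∀ i, Real.log (hA.1.eigenvalues i) ≤
      Real.log m + (hA.1.eigenvalues i / m - 1) := fun i => by
    have := Real.log_le_sub_one_of_pos (div_pos (hpos i) hm)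
    rw [Real.log_div (hpos i).ne' hm.ne'] at this
    linarith
  have hsum : (∑ i, hA.1.eigenvalues i) / m ≤ Fintype.card n := by
    rwa [div_le_iff₀ hm, ← htrace]
  calc ∑ i, Real.log (hA.1.eigenvalues i)
      ≤ ∑ i, (Real.log m + (hA.1.eigenvalues i / m - 1)) := sum_le_sum fun i _ => hlog i
    _ = Fintype.card n * Real.log m +
        ((∑ i, hA.1.eigenvalues i) / m - Fintype.card n) := by
      simp [sum_add_distrib, sum_div]
    _ ≤ Fintype.card n * Real.log m := by linarith

theorem trace_Vmat_le {d : ℕ} (lam : ℝ) {φ : ℕ → Fin d → ℝ} (hφ : ∀ t, φ t ⬝ᵥ φ t ≤ 1) (t : ℕ) :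
    (Vmat lam φ t).trace ≤ lam * d + t := by
  have h := sum_le_sum fun s (_ : s ∈ Finset.Icc 1 t) => hφ s
  simpa [Vmat, trace_sum, trace_vecMulVec] using h

theorem det_Vmat_zero {d : ℕ} (lam : ℝ) (φ : ℕ → Fin d → ℝ) : (Vmat lam φ 0).det = lam ^ d := by
  simp [Vmat]

/-- if `‖φ_t‖₂ ≤ 1` for all `t` then
`log(det V_T / det V_0) ≤ d log(1 + T/(λ d))`. -/
theorem logdet_le {d : ℕ} (lam : ℝ) (hlam : 0 < lam) (T : ℕ)
    (φ : ℕ → Fin d → ℝ) (hφ : ∀ t, Real.sqrt (φ t ⬝ᵥ φ t) ≤ 1) :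
    Real.log ((Vmat lam φ T).det / (Vmat lam φ 0).det)
      ≤ d * Real.log (1 + T / (lam * d)) := by
  obtain rfl | hd := Nat.eq_zero_or_pos d
  · simp
  have hd : (0 : ℝ) < d := by exact_mod_cast hd
  have hm : 0 < 1 + T / (lam * d) := by positivity
  have hV := Vmat_posDef hlam φ T
  have htr : (Vmat lam φ T).trace ≤ Fintype.card (Fin d) * (lam * (1 + T / (lam * d))) := by
    refine (trace_Vmat_le lam (fun t => Real.sqrt_le_one.mp (hφ t)) T).trans_eq ?_
    rw [Fintype.card_fin]
    field_simp
  have hlog := hV.log_det_le_of_trace_le (mul_pos hlam hm) htr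
  rw [Fintype.card_fin, Real.log_mul hlam.ne' hm.ne'] at hlog
  rw [det_Vmat_zero, Real.log_div hV.det_pos.ne' (pow_pos hlam d).ne', Real.log_pow]
  linarith
end

section
/- In the stochastic linear bandit with context distributions with a finite action set X, suppose at round t the algorithm draws L = t i.i.d. samples c̃_{t,1}, …, c̃_{t,t} ~ μ_t, forms ψ̃_{x,μ_t} = (1/t) Σ_{l=1}^t φ_{x,c̃_{t,l}}, and chooses an action x_t depending on the samples. Then with probability at least 1−δ, simultaneously for all T ∈ ℕ: Σ_{t=1}^T (ψ̃_{x_t,μ_t} − ψ̄_{x_t,μ_t})ᵀθ ≤ 4√(T log(|X| π² T² / (6δ))). -/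
open MeasureTheory ProbabilityTheory Matrix Finset Real

/-- One-sided Hoeffding bound for samples that are conditionally i.i.d. given a sub-σ-algebra,
centred at the (random) mean of their conditional law. -/
theorem measureReal_condIID_sum_ge_le {Ω C : Type*} {m m0 : MeasurableSpace Ω} [MeasurableSpace C]
    (μ : Measure Ω) [IsProbabilityMeasure μ] (hm : m ≤ m0)
    {n : ℕ} (hn : 1 ≤ n) {ν : Ω → Measure C} (hν : ∀ ω, IsProbabilityMeasure (ν ω))
    {c : ℕ → Ω → C} (hc : ∀ l, Measurable (c l))
    (hiid : ∀ g : ℕ → C → ℝ, (∀ l, Measurable (g l)) → (∀ l cc, |g l cc| ≤ 1) →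
      μ[fun ω => ∏ l ∈ Finset.Icc 1 n, g l (c l ω) | m]
        =ᵐ[μ] fun ω => ∏ l ∈ Finset.Icc 1 n, ∫ cc, g l cc ∂(ν ω))
    {f : C → ℝ} (hf : Measurable f) (hfb : ∀ cc, |f cc| ≤ 1) {ε : ℝ} (hε : 0 ≤ ε) :
    μ.real {ω | n * ε ≤ ∑ l ∈ Finset.Icc 1 n, f (c l ω) - n * ∫ cc, f cc ∂(ν ω)}
      ≤ exp (-(n * ε ^ 2 / 2)) := by
  have hmean : μ[fun ω => f (c 1 ω) | m] =ᵐ[μ] fun ω => ∫ cc, f cc ∂(ν ω) := by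
    have h := hiid (fun l => if l = 1 then f else fun _ => 1)
      (fun l => by split_ifs <;> fun_prop) (fun l cc => by split_ifs <;> simp [hfb])
    convert h using 2
    · ext ω
      rw [Finset.prod_eq_single_of_mem 1 (by simp [hn]) (fun b _ hb => by simp [hb])]
      simp
    · rw [Finset.prod_eq_single_of_mem 1 (by simp [hn]) (fun b _ hb => by simp [hb])]
      simp
  set M := μ[fun ω => f (c 1 ω) | m]
  have hMmeas : StronglyMeasurable[m] M := stronglyMeasurable_condExp
  set S : Ω → ℝ := fun ω => ∑ l ∈ Finset.Icc 1 n, f (c l ω) - n * ∫ cc, f cc ∂(ν ω) with hS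
  have hSmeas : AEMeasurable S μ := by
    have h1 : AEMeasurable (fun ω => ∫ cc, f cc ∂(ν ω)) μ :=
      ⟨M, (hMmeas.mono hm).measurable, hmean.symm⟩
    have h2 : Measurable fun ω => ∑ l ∈ Finset.Icc 1 n, f (c l ω) :=
      Finset.measurable_sum _ fun l _ => hf.comp (hc l)
    exact h2.aemeasurable.sub (h1.const_mul (n : ℝ))
  have hmb : ∀ ω, |∫ cc, f cc ∂(ν ω)| ≤ 1 := fun ω => by
    have := hν ω
    simpa using norm_integral_le_of_norm_le_const (μ := ν ω) (f := f) (C := 1)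
      (Filter.Eventually.of_forall fun cc => by simpa using hfb cc)
  have hSb : ∀ ω, S ω ≤ 2 * n := fun ω => by
    have h1 : ∑ l ∈ Finset.Icc 1 n, f (c l ω) ≤ n := by
      simpa using Finset.sum_le_card_nsmul (Finset.Icc 1 n) (fun l => f (c l ω)) 1
        fun l _ => (abs_le.1 (hfb _)).2
    have h2 := (abs_le.1 (hmb ω)).1
    have h3 : (0 : ℝ) ≤ n := n.cast_nonneg
    simp only [hS]
    nlinarith
  have hint : Integrable (fun ω => exp (ε * S ω)) μ := by
    refine Integrable.of_bound (measurable_exp.comp_aemeasurable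
      (hSmeas.const_mul ε)).aestronglyMeasurable (exp (ε * (2 * n)))
      (Filter.Eventually.of_forall fun ω => ?_)
    rw [Real.norm_eq_abs, abs_of_pos (exp_pos _)]
    exact exp_le_exp.2 (mul_le_mul_of_nonneg_left (hSb ω) hε)
  set W : Ω → ℝ := fun ω => exp (-(ε * n * M ω)) with hW
  set P : Ω → ℝ := fun ω => ∏ l ∈ Finset.Icc 1 n, exp (ε * (f (c l ω) - 1)) with hP
  have hgm : Measurable fun cc => exp (ε * (f cc - 1)) := by fun_prop
  have hgb : ∀ cc, |exp (ε * (f cc - 1))| ≤ 1 := fun cc => by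
    rw [abs_of_pos (exp_pos _), exp_le_one_iff]
    exact mul_nonpos_of_nonneg_of_nonpos hε (by linarith [(abs_le.1 (hfb cc)).2])
  have hPint : Integrable P μ := by
    refine Integrable.of_bound (Finset.measurable_prod _
      fun l _ => hgm.comp (hc l)).aestronglyMeasurable 1 (Filter.Eventually.of_forall fun ω => ?_)
    simp only [hP, Real.norm_eq_abs, Finset.abs_prod]
    exact Finset.prod_le_one (fun _ _ => abs_nonneg _) fun _ _ => hgb _
  have hWP : W * P =ᵐ[μ] fun ω => exp (-(ε * n)) * exp (ε * S ω) := by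
    filter_upwards [hmean] with ω hω
    simp only [Pi.mul_apply, hW, hP, hS, hω]
    rw [← exp_sum, ← exp_add, ← exp_add]
    congr 1
    simp only [← Finset.mul_sum, Finset.sum_sub_distrib, Finset.sum_const, Nat.card_Icc]
    simp
    ring
  have hWPint : Integrable (W * P) μ := (hint.const_mul _).congr hWP.symm
  have hWmeas : StronglyMeasurable[m] W :=
    continuous_exp.comp_stronglyMeasurable (hMmeas.const_mul (ε * n)).neg
  have hcond : μ[W * P | m] ≤ᵐ[μ] fun _ => exp (n * (ε ^ 2 / 2 - ε)) := by
    filter_upwards [condExp_mul_of_stronglyMeasurable_left hWmeas hWPint hPint,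
      hiid (fun _ cc => exp (ε * (f cc - 1))) (fun _ => hgm) (fun _ => hgb), hmean] with ω h1 h2 h3
    rw [h1, Pi.mul_apply, h2]
    have := hν ω
    have hsub := (hasSubgaussianMGF_of_mem_Icc (μ := ν ω) (X := f) (a := -1) (b := 1)
      hf.aemeasurable (Filter.Eventually.of_forall fun cc => abs_le.1 (hfb cc))).mgf_le ε
    have hc1 : (((‖(1 : ℝ) - -1‖₊ / 2) ^ 2 : NNReal) : ℝ) = 1 := by
      norm_num
    rw [hc1, mgf] at hsub
    have hfac : exp (-(ε * ∫ cc, f cc ∂(ν ω))) * ∫ cc, exp (ε * (f cc - 1)) ∂(ν ω)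
        ≤ exp (ε ^ 2 / 2 - ε) := by
      have : exp (-(ε * ∫ cc, f cc ∂(ν ω))) * ∫ cc, exp (ε * (f cc - 1)) ∂(ν ω)
          = exp (-ε) * ∫ cc, exp (ε * (f cc - ∫ cc, f cc ∂(ν ω))) ∂(ν ω) := by
        rw [← integral_const_mul (exp _), ← integral_const_mul (exp (-ε))]
        refine integral_congr_ae (Filter.Eventually.of_forall fun cc => ?_)
        simp only
        rw [← exp_add, ← exp_add]
        congr 1
        ring
      rw [this, sub_eq_neg_add, exp_add]
      gcongr
      simpa using hsub
    have hpow : W ω * ∏ l ∈ Finset.Icc 1 n, ∫ cc, exp (ε * (f cc - 1)) ∂(ν ω)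
        = (exp (-(ε * ∫ cc, f cc ∂(ν ω))) * ∫ cc, exp (ε * (f cc - 1)) ∂(ν ω)) ^ n := by
      simp only [hW, h3, Finset.prod_const, Nat.card_Icc, Nat.add_sub_cancel, mul_pow,
        ← exp_nat_mul]
      congr 2
      ring
    rw [hpow, exp_nat_mul]
    exact pow_le_pow_left₀ (mul_nonneg (exp_pos _).le
      (integral_nonneg fun _ => (exp_pos _).le)) hfac n
  have hmgf : exp (-(ε * n)) * mgf S μ ε ≤ exp (n * (ε ^ 2 / 2 - ε)) := by
    rw [mgf, ← integral_const_mul, ← integral_congr_ae hWP, ← integral_condExp hm]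
    simpa using integral_mono_ae integrable_condExp (integrable_const _) hcond
  refine (measure_ge_le_exp_mul_mgf (n * ε) hε hint).trans ?_
  have h4 : exp (-ε * (n * ε)) * mgf S μ ε
      = exp (ε * n - n * ε ^ 2) * (exp (-(ε * n)) * mgf S μ ε) := by
    rw [← mul_assoc (exp _), ← exp_add]
    congr 2
    ring
  rw [h4]
  refine (mul_le_mul_of_nonneg_left hmgf (exp_pos _).le).trans (le_of_eq ?_)
  rw [← exp_add]
  congr 1
  ring

theorem sum_Icc_inv_sqrt_le (T : ℕ) : ∑ t ∈ Finset.Icc 1 T, (√(t : ℝ))⁻¹ ≤ 2 * √(T : ℝ) := by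
  induction T with
  | zero => simp
  | succ k ih =>
    rw [Finset.sum_Icc_succ_top (by omega)]
    refine (add_le_add_left ih _).trans ?_
    have h1 : 0 < √((k + 1 : ℕ) : ℝ) := sqrt_pos.2 (by positivity)
    have h2 : √((k + 1 : ℕ) : ℝ) ^ 2 = k + 1 := by rw [sq_sqrt (by positivity)]; simp
    have h3 : √(k : ℝ) ^ 2 = k := sq_sqrt k.cast_nonneg
    refine le_of_mul_le_mul_right ?_ h1
    rw [add_mul, inv_mul_cancel₀ h1.ne']
    nlinarith [sq_nonneg (√((k + 1 : ℕ) : ℝ) - √(k : ℝ))]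

theorem abs_dotProduct_le_one {d : ℕ} {u v : Fin d → ℝ} (hu : √(u ⬝ᵥ u) ≤ 1)
    (hv : √(v ⬝ᵥ v) ≤ 1) : |u ⬝ᵥ v| ≤ 1 := by
  rw [sqrt_le_one] at hu hv
  have h := Finset.sum_mul_sq_le_sq_mul_sq Finset.univ u v
  rw [← sq_le_one_iff_abs_le_one]
  simp only [dotProduct, ← sq] at hu hv ⊢
  exact h.trans (mul_le_one₀ hu (Finset.sum_nonneg fun _ _ => sq_nonneg _) hv)

theorem integrable_of_sqrt_dotProduct_self_le_one {d : ℕ} {C : Type*} [MeasurableSpace C]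
    {ν : Measure C} [IsFiniteMeasure ν] {φ : C → Fin d → ℝ} (hφ : Measurable φ)
    (hb : ∀ cc, √(φ cc ⬝ᵥ φ cc) ≤ 1) : Integrable φ ν := by
  refine Integrable.of_bound hφ.aestronglyMeasurable 1 (Filter.Eventually.of_forall fun cc => ?_)
  rw [pi_norm_le_iff_of_nonneg zero_le_one]
  intro i
  have h := hb cc
  rw [sqrt_le_one, dotProduct] at h
  rw [Real.norm_eq_abs, ← sq_le_one_iff_abs_le_one, sq]
  exact (Finset.single_le_sum (f := fun i => φ cc i * φ cc i)
    (fun i _ => mul_self_nonneg _) (Finset.mem_univ i)).trans h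

theorem integral_dotProduct_const {d : ℕ} {C : Type*} [MeasurableSpace C]
    {ν : Measure C} {φ : C → Fin d → ℝ} (hφ : Integrable φ ν) (θ : Fin d → ℝ) :
    (∫ cc, φ cc ∂ν) ⬝ᵥ θ = ∫ cc, φ cc ⬝ᵥ θ ∂ν := by
  have hφ' := fun i => hφ.eval i
  simp only [dotProduct]
  rw [integral_finsetSum _ fun i _ => (hφ' i).mul_const _]
  refine Finset.sum_congr rfl fun i _ => ?_
  rw [eval_integral hφ', integral_mul_const]

theorem one_lt_card_mul_pi_sq_mul_sq_div {k t δ : ℝ} (hk : 1 ≤ k) (ht : 1 ≤ t) (hδ : 0 < δ)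
    (hδ1 : δ < 1) : 1 < k * π ^ 2 * t ^ 2 / (6 * δ) := by
  rw [lt_div_iff₀ (by positivity)]
  have h1 : 1 ≤ k * t ^ 2 := one_le_mul_of_one_le_of_one_le hk (one_le_pow₀ ht)
  have h2 : 9 < π ^ 2 := by nlinarith [pi_gt_three]
  nlinarith

/-- in the stochastic linear bandit with context distributions with a
finite action set `X`, if at round `t` the algorithm draws `L = t` i.i.d. samples
`c̃_{t,1}, …, c̃_{t,t} ~ μ_t`, forms `ψ̃_{x,μ_t} = (1/t) Σ_l φ_{x,c̃_{t,l}}`, and chooses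
an action `x_t` depending on the samples, then with probability at least `1 − δ`,
simultaneously for all `T`,
`Σ_{t=1}^T (ψ̃_{x_t,μ_t} − ψ̄_{x_t,μ_t})ᵀθ ≤ 4 √(T log(|X| π² T² / (6δ)))`. -/
theorem sampled_feature_bias_sum_bound {d : ℕ} {Ω C : Type*}
    {m0 : MeasurableSpace Ω} [MeasurableSpace C]
    (μ : Measure Ω) [IsProbabilityMeasure μ]
    (ℱ : ℕ → MeasurableSpace Ω) (hℱmono : Monotone ℱ) (hℱle : ∀ t, ℱ t ≤ m0)
    -- 𝒢_t is the decision-time information: F_{t-1}, μ_t, and the samples of round t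
    (𝒢 : ℕ → MeasurableSpace Ω) (h𝒢low : ∀ t, 1 ≤ t → ℱ (t - 1) ≤ 𝒢 t)
    (h𝒢high : ∀ t, 𝒢 t ≤ ℱ t)
    (X : Type*) [Nonempty X] [Fintype X] [MeasurableSpace X]
    (θ : Fin d → ℝ) (hθ : Real.sqrt (θ ⬝ᵥ θ) ≤ 1)
    (φ : X → C → Fin d → ℝ) (hφmeas : ∀ x, Measurable (φ x))
    (hφbd : ∀ x cc, Real.sqrt (φ x cc ⬝ᵥ φ x cc) ≤ 1)
    -- context distributions μ_t, adaptively chosen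
    (ν : ℕ → Ω → Measure C) (hνprob : ∀ t ω, IsProbabilityMeasure (ν t ω))
    (hνmeas : ∀ t (s : Set C), MeasurableSet s →
      Measurable[𝒢 t] fun ω => (ν t ω s).toReal)
    -- at round t, samples c̃_{t,1}, …, c̃_{t,t}, conditionally i.i.d. ~ μ_t given F_{t-1}
    (ctil : ℕ → ℕ → Ω → C) (hctilmeas : ∀ t l, Measurable[𝒢 t] (ctil t l))
    (hctiliid : ∀ t, 1 ≤ t → ∀ g : ℕ → C → ℝ, (∀ l, Measurable (g l)) →
      (∀ l cc, |g l cc| ≤ 1) →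
      μ[fun ω => ∏ l ∈ Finset.Icc 1 t, g l (ctil t l ω) | ℱ (t - 1)]
        =ᵐ[μ] fun ω => ∏ l ∈ Finset.Icc 1 t, ∫ cc, g l cc ∂(ν t ω))
    -- x_t may depend on the drawn samples (it is 𝒢_t-measurable)
    (act : ℕ → Ω → X) (hactmeas : ∀ t, Measurable[𝒢 t] (act t))
    (δ : ℝ) (hδ : 0 < δ) (hδ1 : δ < 1) :
    1 - δ ≤
      (μ {ω | ∀ T : ℕ,
        ∑ t ∈ Finset.Icc 1 T,
            ((t : ℝ)⁻¹ • ∑ l ∈ Finset.Icc 1 t, φ (act t ω) (ctil t l ω)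
              - ∫ cc, φ (act t ω) cc ∂(ν t ω)) ⬝ᵥ θ
          ≤ 4 * Real.sqrt (T *
              Real.log ((Fintype.card X) * π ^ 2 * T ^ 2 / (6 * δ)))}).toReal := by
  have hcard : (1 : ℝ) ≤ Fintype.card X := by exact_mod_cast Fintype.card_pos
  set A : ℝ → ℝ := fun t => Fintype.card X * π ^ 2 * t ^ 2 / (6 * δ) with hA
  have hA1 : ∀ t : ℝ, 1 ≤ t → 1 < A t := fun t ht =>
    one_lt_card_mul_pi_sq_mul_sq_div hcard ht hδ hδ1
  set ε : ℕ → ℝ := fun t => √(2 * log (A t)) * (√(t : ℝ))⁻¹ with hεdef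
  have hε0 : ∀ t, 0 ≤ ε t := fun t => by positivity
  set B : ℕ → X → Set Ω := fun t x => {ω | t * ε t ≤
    ∑ l ∈ Finset.Icc 1 t, φ x (ctil t l ω) ⬝ᵥ θ - t * ∫ cc, φ x cc ⬝ᵥ θ ∂(ν t ω)} with hB
  have hBle : ∀ t, 1 ≤ t → ∀ x, μ (B t x) ≤ ENNReal.ofReal ((A t)⁻¹) := by
    intro t ht x
    have ht' : (1 : ℝ) ≤ t := by exact_mod_cast ht
    have hAt := hA1 t ht'
    have h := measureReal_condIID_sum_ge_le μ (hℱle (t - 1)) ht (hνprob t)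
      (fun l => (hctilmeas t l).mono ((h𝒢high t).trans (hℱle t)) le_rfl) (hctiliid t ht)
      (f := fun cc => φ x cc ⬝ᵥ θ)
      (by
        have := hφmeas x
        simp only [dotProduct]
        fun_prop)
      (fun cc => abs_dotProduct_le_one (hφbd x cc) hθ) (hε0 t)
    have hexp : exp (-(t * ε t ^ 2 / 2)) = (A t)⁻¹ := by
      have h0 : (0 : ℝ) < t := by linarith
      have : t * ε t ^ 2 / 2 = log (A t) := by
        simp only [hεdef]
        rw [mul_pow, inv_pow, sq_sqrt h0.le, sq_sqrt (by linarith [log_pos hAt])]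
        field_simp
      rw [this, Real.exp_neg, exp_log (by linarith)]
    rw [hexp] at h
    rw [← ofReal_measureReal]
    exact ENNReal.ofReal_le_ofReal h
  have hsum : HasSum (fun t : ℕ => Fintype.card X * (A (t + 1 : ℕ))⁻¹) δ := by
    have h1 : HasSum (fun t : ℕ => 1 / ((t + 1 : ℕ) : ℝ) ^ 2) (π ^ 2 / 6) := by
      rw [hasSum_nat_add_iff (f := fun n : ℕ => 1 / (n : ℝ) ^ 2)]
      simpa using hasSum_zeta_two
    have h2 := h1.mul_left (6 * δ / π ^ 2)
    rw [show 6 * δ / π ^ 2 * (π ^ 2 / 6) = δ by field_simp] at h2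
    refine h2.congr_fun fun t => ?_
    simp only [hA]
    have : (Fintype.card X : ℝ) ≠ 0 := by linarith
    field_simp
  have hbad : μ (⋃ t : ℕ, ⋃ x, B (t + 1) x) ≤ ENNReal.ofReal δ := by
    calc μ (⋃ t : ℕ, ⋃ x, B (t + 1) x) ≤ ∑' t : ℕ, μ (⋃ x, B (t + 1) x) := measure_iUnion_le _
      _ ≤ ∑' t : ℕ, ENNReal.ofReal (Fintype.card X * (A (t + 1 : ℕ))⁻¹) := by
        refine ENNReal.tsum_le_tsum fun t => ?_
        refine (measure_iUnion_fintype_le μ _).trans ?_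
        refine (Finset.sum_le_sum fun x _ => hBle (t + 1) (by omega) x).trans ?_
        rw [Finset.sum_const, Finset.card_univ, nsmul_eq_mul,
          ENNReal.ofReal_mul (by positivity), ENNReal.ofReal_natCast]
      _ = ENNReal.ofReal δ := by
        rw [← ENNReal.ofReal_tsum_of_nonneg (fun t => by positivity) hsum.summable, hsum.tsum_eq]
  have hbound : ∀ T : ℕ, ∑ t ∈ Finset.Icc 1 T, ε t ≤ 4 * √(T * log (A T)) := by
    intro T
    rcases Nat.eq_zero_or_pos T with rfl | hT
    · simp
    have hT' : (1 : ℝ) ≤ T := by exact_mod_cast hT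
    have hlog : 0 ≤ log (A T) := (log_pos (hA1 T hT')).le
    calc ∑ t ∈ Finset.Icc 1 T, ε t
        ≤ ∑ t ∈ Finset.Icc 1 T, √(2 * log (A T)) * (√(t : ℝ))⁻¹ := by
          refine Finset.sum_le_sum fun t ht => ?_
          rw [Finset.mem_Icc] at ht
          have ht1 : (1 : ℝ) ≤ t := by exact_mod_cast ht.1
          have htT : (t : ℝ) ≤ T := by exact_mod_cast ht.2
          have hAt := hA1 t ht1
          have hAA : A t ≤ A T := by
            simp only [hA]
            gcongr
          have := log_le_log (by linarith) hAA
          simp only [hεdef]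
          gcongr
      _ ≤ √(2 * log (A T)) * (2 * √(T : ℝ)) := by
          rw [← Finset.mul_sum]
          exact mul_le_mul_of_nonneg_left (sum_Icc_inv_sqrt_le T) (sqrt_nonneg _)
      _ ≤ 4 * √(T * log (A T)) := by
          rw [sqrt_mul (by norm_num), sqrt_mul (by positivity)]
          have h2 : √(2 : ℝ) ≤ 2 := by
            rw [sqrt_le_left (by norm_num)]
            norm_num
          have h3 : 0 ≤ √(log (A T)) * √(T : ℝ) := by positivity
          nlinarith
  set G : Set Ω := {ω | ∀ T : ℕ, ∑ t ∈ Finset.Icc 1 T,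
      ((t : ℝ)⁻¹ • ∑ l ∈ Finset.Icc 1 t, φ (act t ω) (ctil t l ω)
        - ∫ cc, φ (act t ω) cc ∂(ν t ω)) ⬝ᵥ θ ≤ 4 * √(T * log (A T))} with hG
  have hcover : Set.univ ⊆ G ∪ ⋃ t : ℕ, ⋃ x, B (t + 1) x := by
    intro ω _
    rw [Set.mem_union, or_iff_not_imp_right]
    intro hω T
    refine (Finset.sum_le_sum fun t ht => ?_).trans (hbound T)
    obtain ⟨s, rfl⟩ : ∃ s, t = s + 1 := ⟨t - 1, by have := (Finset.mem_Icc.1 ht).1; omega⟩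
    have hnot : ω ∉ B (s + 1) (act (s + 1) ω) := fun h =>
      hω (Set.mem_iUnion.2 ⟨s, Set.mem_iUnion.2 ⟨_, h⟩⟩)
    simp only [hB, Set.mem_ofPred_eq, not_le] at hnot
    have := hνprob (s + 1) ω
    rw [sub_dotProduct, smul_dotProduct, sum_dotProduct, smul_eq_mul,
      integral_dotProduct_const
        (integrable_of_sqrt_dotProduct_self_le_one (hφmeas _) (hφbd _))]
    have hs : (0 : ℝ) < ((s + 1 : ℕ) : ℝ) := by positivity
    refine le_of_mul_le_mul_left ?_ hs
    rw [mul_sub, mul_inv_cancel_left₀ hs.ne']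
    exact hnot.le
  have hone : (1 : ENNReal) ≤ μ G + ENNReal.ofReal δ := by
    rw [← measure_univ (μ := μ)]
    exact (measure_mono hcover).trans ((measure_union_le _ _).trans (by gcongr))
  have hreal := ENNReal.toReal_mono (by finiteness) hone
  rw [ENNReal.toReal_add (by finiteness) (by finiteness), ENNReal.toReal_ofReal hδ.le,
    ENNReal.toReal_one] at hreal
  linarith
end
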